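/- Let 0 < p < 1 and θ ∈ (0,1]. Then the lower and upper θ-intermediate dimensions of the polynomial spiral S_p both equal 1 + θ(1-p)/(2p + θ(1-p)), i.e. lodim_θ(S_p) = updim_θ(S_p) = 1 + θ(1-p)/(2p + θ(1-p)). -/

import Mathlib

open Set Metric Filter

/-- The upper θ-intermediate dimension of a set `E` in a metric space:
the infimum of all `s ≥ 0` such that for every `ε > 0` there is `δ₀ > 0` such that for all
`0 < δ < δ₀` there is a countable cover `𝒰` of `E` with `δ ≤ diam U ≤ δ ^ θ` for all `U ∈ 𝒰`
and `∑_{U ∈ 𝒰} (diam U) ^ s ≤ ε`. -/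
noncomputable def updim {X : Type*} [PseudoMetricSpace X] (θ : ℝ) (E : Set X) : ℝ :=
  sInf {s : ℝ | 0 ≤ s ∧ ∀ ε : ℝ, 0 < ε → ∃ δ₀ : ℝ, 0 < δ₀ ∧ ∀ δ : ℝ, 0 < δ → δ < δ₀ →
    ∃ 𝒰 : Set (Set X), 𝒰.Countable ∧ E ⊆ ⋃₀ 𝒰 ∧
      (∀ U ∈ 𝒰, δ ≤ diam U ∧ diam U ≤ δ ^ θ) ∧
      ∑' U : 𝒰, ENNReal.ofReal (diam (U : Set X) ^ s) ≤ ENNReal.ofReal ε}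

/-- The lower θ-intermediate dimension of a set `E` in a metric space. -/
noncomputable def lodim {X : Type*} [PseudoMetricSpace X] (θ : ℝ) (E : Set X) : ℝ :=
  sInf {s : ℝ | 0 ≤ s ∧ ∀ ε : ℝ, 0 < ε → ∀ δ₀ : ℝ, 0 < δ₀ → ∃ δ : ℝ, 0 < δ ∧ δ < δ₀ ∧
    ∃ 𝒰 : Set (Set X), 𝒰.Countable ∧ E ⊆ ⋃₀ 𝒰 ∧
      (∀ U ∈ 𝒰, δ ≤ diam U ∧ diam U ≤ δ ^ θ) ∧
      ∑' U : 𝒰, ENNReal.ofReal (diam (U : Set X) ^ s) ≤ ENNReal.ofReal ε}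

/-- The polynomial spiral `S_p = {(t^{-p} sin(πt), t^{-p} cos(πt)) : t ≥ 1} ⊆ ℝ²`. -/
noncomputable def polySpiral (p : ℝ) : Set (EuclideanSpace ℝ (Fin 2)) :=
  {x | ∃ t : ℝ, 1 ≤ t ∧ x 0 = t ^ (-p) * Real.sin (Real.pi * t) ∧
    x 1 = t ^ (-p) * Real.cos (Real.pi * t)}

/-- The spiral curve. -/
noncomputable def spC (p t : ℝ) : EuclideanSpace ℝ (Fin 2) :=
  !₂[t ^ (-p) * Real.sin (Real.pi * t), t ^ (-p) * Real.cos (Real.pi * t)]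

lemma spC_mem {p t : ℝ} (ht : 1 ≤ t) : spC p t ∈ polySpiral p :=
  ⟨t, ht, by simp [spC], by simp [spC]⟩

lemma mem_spC {p : ℝ} {x : EuclideanSpace ℝ (Fin 2)} (hx : x ∈ polySpiral p) :
    ∃ t, 1 ≤ t ∧ x = spC p t := by
  obtain ⟨t, ht, h0, h1⟩ := hx
  refine ⟨t, ht, ?_⟩
  ext i
  fin_cases i
  · simpa [spC] using h0
  · simpa [spC] using h1

lemma spC_dist_sq (p t t' : ℝ) :
    dist (spC p t) (spC p t') ^ 2 = (t ^ (-p) - t' ^ (-p)) ^ 2 +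
      4 * (t ^ (-p) * t' ^ (-p)) * Real.sin (Real.pi * (t - t') / 2) ^ 2 := by
  rw [EuclideanSpace.dist_eq, Real.sq_sqrt (by positivity)]
  simp only [Fin.sum_univ_two, Real.dist_eq, sq_abs]
  have h : Real.sin (Real.pi * (t - t') / 2) ^ 2 =
      (1 - (Real.cos (Real.pi * t) * Real.cos (Real.pi * t') +
        Real.sin (Real.pi * t) * Real.sin (Real.pi * t'))) / 2 := by
    rw [← Real.cos_sub, Real.sin_sq_eq_half_sub]
    ring_nf
  rw [h]
  simp only [spC, PiLp.toLp_apply, Matrix.cons_val_zero, Matrix.cons_val_one]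
  have h1 := Real.sin_sq_add_cos_sq (Real.pi * t)
  have h2 := Real.sin_sq_add_cos_sq (Real.pi * t')
  linear_combination (t ^ (-p)) ^ 2 * h1 + (t' ^ (-p)) ^ 2 * h2

lemma spC_radial {p T t t' : ℝ} (hp : 0 < p) (hT : 1 ≤ T) (ht : T ≤ t) (htt : t ≤ t')
    (ht' : t' ≤ 2 * T) :
    t' - t ≤ dist (spC p t) (spC p t') * ((2 * T) ^ (p + 1) / p) := by
  rcases htt.eq_or_lt with h | h
  · subst h; simp
  have h1 : |t ^ (-p) - t' ^ (-p)| ≤ dist (spC p t) (spC p t') := by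
    refine abs_le_of_sq_le_sq ?_ dist_nonneg
    rw [spC_dist_sq]
    have : 0 ≤ t ^ (-p) * t' ^ (-p) := mul_nonneg (Real.rpow_nonneg (by linarith) _)
      (Real.rpow_nonneg (by linarith) _)
    have := mul_nonneg this (sq_nonneg (Real.sin (Real.pi * (t - t') / 2)))
    linarith
  obtain ⟨c, hc, hc'⟩ := exists_hasDerivAt_eq_slope (fun x : ℝ => x ^ (-p))
    (fun x : ℝ => (-p) * x ^ (-p - 1)) h
    (fun x hx => (Real.continuousAt_rpow_const x (-p)
      (Or.inl (by linarith [hx.1] : 0 < x).ne')).continuousWithinAt)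
    (fun x hx => Real.hasDerivAt_rpow_const (Or.inl (by linarith [hx.1] : 0 < x).ne'))
  have hc0 : 0 < c := by linarith [hc.1]
  have h2 : (2 * T) ^ (-p - 1) ≤ c ^ (-p - 1) :=
    Real.rpow_le_rpow_of_nonpos hc0 (by linarith [hc.2]) (by linarith)
  have h3 : (2 * T) ^ (-p - 1) = ((2 * T) ^ (p + 1))⁻¹ := by
    rw [← Real.rpow_neg (by linarith)]; ring_nf
  have hW : 0 < (2 * T) ^ (p + 1) := Real.rpow_pos_of_pos (by linarith) _
  rw [eq_div_iff (by linarith)] at hc'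
  have h4 : p * (2 * T) ^ (-p - 1) * (t' - t) ≤ dist (spC p t) (spC p t') := by
    have : p * (2 * T) ^ (-p - 1) * (t' - t) ≤ p * c ^ (-p - 1) * (t' - t) := by
      have : 0 ≤ t' - t := by linarith
      gcongr
    have := le_abs_self (t ^ (-p) - t' ^ (-p))
    linarith
  rw [h3] at h4
  rw [← mul_div_assoc, le_div_iff₀ hp]
  calc (t' - t) * p = p * ((2 * T) ^ (p + 1))⁻¹ * (t' - t) * (2 * T) ^ (p + 1) := by
        field_simp
    _ ≤ _ := by gcongr

lemma spC_angular {p T t t' : ℝ} (hp : 0 < p) (hT : 1 ≤ T) (ht : T ≤ t) (htt : t ≤ t')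
    (ht' : t' ≤ 2 * T) (h1 : t' - t ≤ 1) :
    t' - t ≤ dist (spC p t) (spC p t') * (2 * T) ^ p := by
  have hA : ∀ x, T ≤ x → x ≤ 2 * T → (2 * T) ^ (-p) ≤ x ^ (-p) := fun x hx hx' =>
    Real.rpow_le_rpow_of_nonpos (by linarith) hx' (by linarith)
  have hW : 0 < (2 * T) ^ (-p) := Real.rpow_pos_of_pos (by linarith) _
  have hs : t' - t ≤ Real.sin (Real.pi * (t' - t) / 2) := by
    have hpi := Real.pi_pos
    have := Real.mul_le_sin (x := Real.pi * (t' - t) / 2)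
      (by have : 0 ≤ t' - t := by linarith
          positivity) (by nlinarith)
    calc t' - t = 2 / Real.pi * (Real.pi * (t' - t) / 2) := by field_simp
      _ ≤ _ := this
  have h2 : (2 * T) ^ (-p) * (t' - t) ≤ dist (spC p t) (spC p t') := by
    apply le_of_sq_le_sq _ dist_nonneg
    rw [spC_dist_sq]
    have e : Real.sin (Real.pi * (t - t') / 2) ^ 2 = Real.sin (Real.pi * (t' - t) / 2) ^ 2 := by
      rw [show Real.pi * (t - t') / 2 = -(Real.pi * (t' - t) / 2) by ring, Real.sin_neg, neg_sq]
    rw [e]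
    have h3 : (2 * T) ^ (-p) * (2 * T) ^ (-p) ≤ t ^ (-p) * t' ^ (-p) := by
      have := hA t ht (by linarith)
      have := hA t' (by linarith) ht'
      have : 0 ≤ t ^ (-p) := by linarith
      gcongr
    have h4 : (t' - t) ^ 2 ≤ Real.sin (Real.pi * (t' - t) / 2) ^ 2 := by
      have : 0 ≤ t' - t := by linarith
      gcongr
    have h5 : (2 * T) ^ (-p) * (2 * T) ^ (-p) * (t' - t) ^ 2 ≤
      t ^ (-p) * t' ^ (-p) * Real.sin (Real.pi * (t' - t) / 2) ^ 2 :=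
      mul_le_mul h3 h4 (sq_nonneg _) ((mul_nonneg hW.le hW.le).trans h3)
    have h6 : 0 ≤ (2 * T) ^ (-p) * (2 * T) ^ (-p) * (t' - t) ^ 2 := by positivity
    nlinarith [sq_nonneg (t ^ (-p) - t' ^ (-p))]
  have h3 : (2 * T) ^ (-p) * (2 * T) ^ p = 1 := by
    rw [← Real.rpow_add (by linarith)]; simp
  have hW : 0 < (2 * T) ^ p := Real.rpow_pos_of_pos (by linarith) _
  calc t' - t = (2 * T) ^ (-p) * (t' - t) * (2 * T) ^ p := by
        linear_combination (-(t' - t)) * h3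
    _ ≤ _ := by gcongr

open MeasureTheory in
lemma vol_small {A : Set ℝ} {m : ℝ}
    (h : ∀ x ∈ A, ∀ y ∈ A, x ≤ y → y - x ≤ m) : volume A ≤ ENNReal.ofReal m := by
  refine (Real.volume_le_diam A).trans (Metric.ediam_le fun x hx y hy => ?_)
  rw [edist_dist]
  apply ENNReal.ofReal_le_ofReal
  rw [Real.dist_eq]
  rcases le_total x y with hxy | hxy
  · rw [abs_sub_comm, abs_of_nonneg (by linarith)]; exact h x hx y hy hxy
  · rw [abs_of_nonneg (by linarith)]; exact h y hy x hx hxy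

open MeasureTheory in
lemma vol_windows {A : Set ℝ} {L m : ℝ} (hL : 0 ≤ L) (hm : 0 ≤ m)
    (h : ∀ x ∈ A, ∀ y ∈ A, x ≤ y → y - x ≤ L)
    (h' : ∀ x ∈ A, ∀ y ∈ A, x ≤ y → y - x ≤ 1 → y - x ≤ m) :
    volume A ≤ ENNReal.ofReal ((L + 1) * m) := by
  rcases A.eq_empty_or_nonempty with rfl | ⟨x0, hx0⟩
  · simp
  have hbdd : BddBelow A := ⟨x0 - L, fun y hy => by
    rcases le_total y x0 with hy' | hy'
    · linarith [h y hy x0 hx0 hy']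
    · linarith⟩
  have ha : ∀ y ∈ A, sInf A ≤ y := fun y hy => csInf_le hbdd hy
  have ha' : ∀ y ∈ A, y - L ≤ sInf A := fun y hy => le_csInf ⟨x0, hx0⟩ fun z hz => by
    rcases le_total z y with hy' | hy'
    · linarith [h z hz y hy hy']
    · linarith
  set a := sInf A
  have hsub : A ⊆ ⋃ k ∈ Finset.range (⌊L⌋₊ + 1), A ∩ Icc (a + k) (a + k + 1) := by
    intro y hy
    simp only [mem_iUnion]
    have h0 : 0 ≤ y - a := by linarith [ha y hy]
    refine ⟨⌊y - a⌋₊, ?_, hy, ?_, ?_⟩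
    · rw [Finset.mem_range, Nat.lt_succ_iff]
      exact Nat.floor_mono (by linarith [ha' y hy])
    · linarith [Nat.floor_le h0]
    · linarith [Nat.lt_floor_add_one (y - a)]
  calc volume A ≤ _ := measure_mono hsub
    _ ≤ _ := measure_biUnion_finset_le _ _
    _ ≤ ∑ k ∈ Finset.range (⌊L⌋₊ + 1), ENNReal.ofReal m := by
        refine Finset.sum_le_sum fun k _ => vol_small ?_
        rintro x ⟨hx, hx1, hx2⟩ y ⟨hy, hy1, hy2⟩ hxy
        exact h' x hx y hy hxy (by linarith)
    _ = ENNReal.ofReal ((⌊L⌋₊ + 1 : ℕ) * m) := by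
        rw [Finset.sum_const, Finset.card_range, nsmul_eq_mul,
          ENNReal.ofReal_mul (by positivity), ENNReal.ofReal_natCast]
    _ ≤ _ := by
        apply ENNReal.ofReal_le_ofReal
        have := Nat.floor_le hL
        push_cast
        gcongr

open MeasureTheory in
lemma vol_preimage {p T : ℝ} (hp : 0 < p) (hT : 1 ≤ T) {U : Set (EuclideanSpace ℝ (Fin 2))}
    (hU : 0 < diam U) :
    volume {t | t ∈ Icc T (2 * T) ∧ spC p t ∈ U} ≤ ENNReal.ofReal
      ((diam U * ((2 * T) ^ (p + 1) / p) + 1) * (diam U * (2 * T) ^ p)) := by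
  have hb : Bornology.IsBounded U := by
    by_contra h
    rw [diam_eq_zero_of_unbounded h] at hU
    exact lt_irrefl _ hU
  have h1 : 0 < (2 * T) ^ (p + 1) := Real.rpow_pos_of_pos (by linarith) _
  have h2 : 0 < (2 * T) ^ p := Real.rpow_pos_of_pos (by linarith) _
  apply vol_windows (by positivity) (by positivity)
  · rintro x ⟨⟨hx1, hx2⟩, hx⟩ y ⟨⟨hy1, hy2⟩, hy⟩ hxy
    refine (spC_radial hp hT hx1 hxy hy2).trans ?_
    have := dist_le_diam_of_mem hb hx hy
    gcongr
  · rintro x ⟨⟨hx1, hx2⟩, hx⟩ y ⟨⟨hy1, hy2⟩, hy⟩ hxy h1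
    refine (spC_angular hp hT hx1 hxy hy2 h1).trans ?_
    have := dist_le_diam_of_mem hb hx hy
    gcongr

/-- The exponent estimate. With `D = 2p + θ(1-p)`, `T = δ^(-θ/D)`. -/
lemma mass_bound {p θ δ d : ℝ} (hp : 0 < p) (hp' : p < 1) (hθ : 0 < θ)
    (hδ : 0 < δ) (h1 : δ ≤ d) (h2 : d ≤ δ ^ θ) {T s : ℝ}
    (hT : T = δ ^ (-(θ / (2 * p + θ * (1 - p)))))
    (hs : s = 1 + θ * (1 - p) / (2 * p + θ * (1 - p))) :
    (d * ((2 * T) ^ (p + 1) / p) + 1) * (d * (2 * T) ^ p) ≤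
      (2 ^ (2 * p + 1) / p + 2 ^ p) * T * d ^ s := by
  have hd : 0 < d := hδ.trans_le h1
  have hT0 : 0 < T := hT ▸ Real.rpow_pos_of_pos hδ _
  have hD : 0 < 2 * p + θ * (1 - p) := by
    have : 0 < 1 - p := by linarith
    positivity
  set D := 2 * p + θ * (1 - p) with hDdef
  have e1 : (2 * T) ^ (p + 1) * (2 * T) ^ p = 2 ^ (2 * p + 1) * T * T ^ (2 * p) := by
    rw [← Real.rpow_add (by positivity), Real.mul_rpow (by norm_num) hT0.le,
      show p + 1 + p = 2 * p + 1 by ring, Real.rpow_add_one hT0.ne']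
    ring
  have e2 : (2 * T) ^ p = 2 ^ p * T * T ^ (p - 1) := by
    rw [Real.mul_rpow (by norm_num) hT0.le, Real.rpow_sub_one hT0.ne']
    field_simp
  have hs2 : 2 - s = 2 * p / D := by
    rw [hs]; field_simp; rw [hDdef]; ring
  have b1 : d ^ 2 * T ^ (2 * p) ≤ d ^ s := by
    have : T ^ (2 * p) = ((δ ^ θ) ^ (2 - s))⁻¹ := by
      rw [hT, ← Real.rpow_mul hδ.le, ← Real.rpow_mul hδ.le, ← Real.rpow_neg hδ.le, hs2]
      congr 1; field_simp
    rw [this, ← div_eq_mul_inv, div_le_iff₀ (by positivity)]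
    calc d ^ 2 = d ^ s * d ^ (2 - s) := by
          rw [← Real.rpow_add hd, ← Real.rpow_natCast]; congr 1; push_cast; ring
      _ ≤ _ := by
          have : 0 ≤ 2 - s := by rw [hs2]; positivity
          gcongr
  have b2 : d * T ^ (p - 1) ≤ d ^ s := by
    have : T ^ (p - 1) = δ ^ (s - 1) := by
      rw [hT, ← Real.rpow_mul hδ.le, hs]
      congr 1; field_simp; ring
    rw [this]
    calc d * δ ^ (s - 1) ≤ d * d ^ (s - 1) := by
          have : 0 ≤ s - 1 := by
            rw [hs]
            have : 0 < 1 - p := by linarith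
            simp only [add_sub_cancel_left]
            positivity
          gcongr
      _ = d ^ s := by
          rw [Real.rpow_sub_one hd.ne']; field_simp
  calc (d * ((2 * T) ^ (p + 1) / p) + 1) * (d * (2 * T) ^ p)
      = d ^ 2 * ((2 * T) ^ (p + 1) * (2 * T) ^ p) / p + d * (2 * T) ^ p := by ring
    _ = 2 ^ (2 * p + 1) / p * T * (d ^ 2 * T ^ (2 * p)) + 2 ^ p * T * (d * T ^ (p - 1)) := by
        rw [e1, e2]; ring
    _ ≤ 2 ^ (2 * p + 1) / p * T * d ^ s + 2 ^ p * T * d ^ s := by gcongr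
    _ = _ := by ring

open MeasureTheory in
lemma lower_mass {p θ δ : ℝ} (hp : 0 < p) (hp' : p < 1) (hθ : 0 < θ)
    (hδ : 0 < δ) (hδ1 : δ < 1) {s : ℝ}
    (hs : s = 1 + θ * (1 - p) / (2 * p + θ * (1 - p)))
    {𝒰 : Set (Set (EuclideanSpace ℝ (Fin 2)))} (hc : 𝒰.Countable)
    (hcov : polySpiral p ⊆ ⋃₀ 𝒰) (hU : ∀ U ∈ 𝒰, δ ≤ diam U ∧ diam U ≤ δ ^ θ) :
    1 ≤ ENNReal.ofReal (2 ^ (2 * p + 1) / p + 2 ^ p) *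
      ∑' U : 𝒰, ENNReal.ofReal (diam (U : Set (EuclideanSpace ℝ (Fin 2))) ^ s) := by
  have hD : 0 < 2 * p + θ * (1 - p) := by
    have : 0 < 1 - p := by linarith
    positivity
  obtain ⟨T, hT⟩ : ∃ T, T = δ ^ (-(θ / (2 * p + θ * (1 - p)))) := ⟨_, rfl⟩
  have hT1 : 1 ≤ T := by
    rw [hT]
    apply Real.one_le_rpow_of_pos_of_le_one_of_nonpos hδ hδ1.le
    have : 0 < θ / (2 * p + θ * (1 - p)) := by positivity
    linarith
  have key : ENNReal.ofReal T ≤ ENNReal.ofReal T *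
      (ENNReal.ofReal (2 ^ (2 * p + 1) / p + 2 ^ p) *
      ∑' U : 𝒰, ENNReal.ofReal (diam (U : Set (EuclideanSpace ℝ (Fin 2))) ^ s)) := by
    calc ENNReal.ofReal T = volume (Icc T (2 * T)) := by
          rw [Real.volume_Icc]; congr 1; ring
      _ ≤ volume (⋃ U ∈ 𝒰, {t | t ∈ Icc T (2 * T) ∧ spC p t ∈ U}) := by
          apply measure_mono
          intro t ht
          obtain ⟨U, hU, hm⟩ := hcov (spC_mem (p := p) (hT1.trans ht.1))
          simp only [mem_iUnion]
          exact ⟨U, hU, ht, hm⟩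
      _ ≤ ∑' U : 𝒰, volume {t | t ∈ Icc T (2 * T) ∧ spC p t ∈ (U : Set _)} :=
          measure_biUnion_le _ hc _
      _ ≤ ∑' U : 𝒰, ENNReal.ofReal T * (ENNReal.ofReal (2 ^ (2 * p + 1) / p + 2 ^ p) *
            ENNReal.ofReal (diam (U : Set (EuclideanSpace ℝ (Fin 2))) ^ s)) := by
          refine ENNReal.tsum_le_tsum fun U => ?_
          have h := hU U U.2
          refine (vol_preimage hp hT1 (hδ.trans_le h.1)).trans ?_
          rw [← ENNReal.ofReal_mul (by positivity), ← ENNReal.ofReal_mul (by positivity)]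
          apply ENNReal.ofReal_le_ofReal
          refine (mass_bound hp hp' hθ hδ h.1 h.2 hT hs).trans (le_of_eq (by ring))
      _ = _ := by rw [ENNReal.tsum_mul_left, ENNReal.tsum_mul_left]
  have h0 : ENNReal.ofReal T ≠ 0 := by simp; linarith
  rw [← ENNReal.mul_le_mul_iff_right h0 ENNReal.ofReal_ne_top, mul_one]
  exact key

lemma lower_bound {p θ : ℝ} (hp : 0 < p) (hp' : p < 1) (hθ : 0 < θ) {s s' : ℝ}
    (hs : s = 1 + θ * (1 - p) / (2 * p + θ * (1 - p)))
    (h : ∀ ε : ℝ, 0 < ε → ∀ δ₀ : ℝ, 0 < δ₀ → ∃ δ : ℝ, 0 < δ ∧ δ < δ₀ ∧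
      ∃ 𝒰 : Set (Set (EuclideanSpace ℝ (Fin 2))), 𝒰.Countable ∧ polySpiral p ⊆ ⋃₀ 𝒰 ∧
      (∀ U ∈ 𝒰, δ ≤ diam U ∧ diam U ≤ δ ^ θ) ∧
      ∑' U : 𝒰, ENNReal.ofReal (diam (U : Set (EuclideanSpace ℝ (Fin 2))) ^ s') ≤
        ENNReal.ofReal ε) : s ≤ s' := by
  by_contra! hlt
  set K : ℝ := 2 ^ (2 * p + 1) / p + 2 ^ p with hK
  have hK0 : 0 < K := by positivity
  obtain ⟨δ, hδ, hδ1, 𝒰, hc, hcov, hU, hsum⟩ := h (1 / (2 * K)) (by positivity) 1 one_pos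
  have h1 := lower_mass hp hp' hθ hδ hδ1 hs hc hcov hU
  have h2 : ∑' U : 𝒰, ENNReal.ofReal (diam (U : Set (EuclideanSpace ℝ (Fin 2))) ^ s) ≤
      ENNReal.ofReal (1 / (2 * K)) := by
    refine le_trans (ENNReal.tsum_le_tsum fun U => ENNReal.ofReal_le_ofReal ?_) hsum
    have h := hU U U.2
    exact Real.rpow_le_rpow_of_exponent_ge (hδ.trans_le h.1)
      (h.2.trans (Real.rpow_le_one hδ.le hδ1.le hθ.le)) hlt.le
  have h3 := h1.trans (mul_le_mul_right h2 _)
  rw [← hK, ← ENNReal.ofReal_mul hK0.le, ← ENNReal.ofReal_one,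
    ENNReal.ofReal_le_ofReal_iff (by positivity)] at h3
  have : K * (1 / (2 * K)) = 1 / 2 := by field_simp
  linarith

lemma dist_le_coord (x y : EuclideanSpace ℝ (Fin 2)) {a b : ℝ} (h0 : |x 0 - y 0| ≤ a)
    (h1 : |x 1 - y 1| ≤ b) : dist x y ≤ a + b := by
  have ha := (abs_nonneg _).trans h0
  have hb := (abs_nonneg _).trans h1
  rw [EuclideanSpace.dist_eq]
  apply Real.sqrt_le_iff.mpr ⟨by positivity, ?_⟩
  simp only [Fin.sum_univ_two, Real.dist_eq]
  nlinarith [pow_le_pow_left₀ (abs_nonneg _) h0 2, pow_le_pow_left₀ (abs_nonneg _) h1 2]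

/-- Lipschitz bound for one coordinate of the reparametrised spiral. -/
lemma coord_lip {p a : ℝ} (hp : 0 < p) (ha : a = 1 / (1 - p)) (hp' : p < 1)
    (f f' : ℝ → ℝ) (hf : ∀ x, HasDerivAt f (f' x) x) (hb : ∀ x, |f x| ≤ 1)
    (hb' : ∀ x, |f' x| ≤ Real.pi) {u v : ℝ} (hu : 1 ≤ u) (hv : 1 ≤ v) :
    |(v ^ a) ^ (-p) * f (v ^ a) - (u ^ a) ^ (-p) * f (u ^ a)| ≤
      (a * p + Real.pi * a) * |v - u| := by
  have h1p : 0 < 1 - p := by linarith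
  have ha0 : 0 < a := by rw [ha]; positivity
  have hexp : a * -p + (a - 1) = 0 := by rw [ha]; field_simp; ring
  have := Convex.norm_image_sub_le_of_norm_hasDerivWithin_le (𝕜 := ℝ)
    (f := fun x : ℝ => x ^ (a * -p) * f (x ^ a))
    (f' := fun x : ℝ => ((a * -p) * x ^ (a * -p - 1)) * f (x ^ a) +
      x ^ (a * -p) * (f' (x ^ a) * (a * x ^ (a - 1)))) (s := Ici 1) (x := u) (y := v)
    (C := a * p + Real.pi * a) ?_ ?_ (convex_Ici 1) hu hv
  · simp only [Real.norm_eq_abs] at this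
    rwa [← Real.rpow_mul (by linarith), ← Real.rpow_mul (by linarith)]
  · intro x hx
    have hx0 : x ≠ 0 := by
      have : (1:ℝ) ≤ x := hx
      linarith
    apply HasDerivAt.hasDerivWithinAt
    apply HasDerivAt.mul
    · exact Real.hasDerivAt_rpow_const (Or.inl hx0)
    · exact (hf (x ^ a)).comp x (Real.hasDerivAt_rpow_const (Or.inl hx0))
  · intro x hx
    have hx1 : (1:ℝ) ≤ x := hx
    have hx0 : 0 < x := by linarith
    have e : x ^ (a * -p) * (f' (x ^ a) * (a * x ^ (a - 1))) = f' (x ^ a) * a := by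
      have : x ^ (a * -p) * x ^ (a - 1) = 1 := by
        rw [← Real.rpow_add hx0, hexp, Real.rpow_zero]
      linear_combination (f' (x ^ a) * a) * this
    have hle : x ^ (a * -p - 1) ≤ 1 := by
      apply Real.rpow_le_one_of_one_le_of_nonpos hx1
      nlinarith [mul_pos ha0 hp]
    have hnn : 0 ≤ x ^ (a * -p - 1) := Real.rpow_nonneg hx0.le _
    rw [Real.norm_eq_abs, e]
    refine (abs_add_le _ _).trans ?_
    rw [abs_mul, abs_mul, abs_mul (f' _), abs_of_pos ha0, abs_of_nonneg hnn,
      show |a * -p| = a * p by rw [mul_neg, abs_neg, abs_of_pos (mul_pos ha0 hp)]]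
    have h1 : a * p * x ^ (a * -p - 1) * |f (x ^ a)| ≤ a * p * 1 * 1 := by
      have := hb (x ^ a)
      gcongr
    have h2 : |f' (x ^ a)| * a ≤ Real.pi * a := by
      have := hb' (x ^ a)
      gcongr
    linarith

lemma spC_lip {p a : ℝ} (hp : 0 < p) (ha : a = 1 / (1 - p)) (hp' : p < 1)
    {u v : ℝ} (hu : 1 ≤ u) (hv : 1 ≤ v) :
    dist (spC p (v ^ a)) (spC p (u ^ a)) ≤ 2 * (a * p + Real.pi * a) * |v - u| := by
  have hpi := Real.pi_pos
  have e : 2 * (a * p + Real.pi * a) * |v - u| =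
    (a * p + Real.pi * a) * |v - u| + (a * p + Real.pi * a) * |v - u| := by ring
  rw [e]
  apply dist_le_coord
  · have := coord_lip hp ha hp' (fun x => Real.sin (Real.pi * x))
      (fun x => Real.cos (Real.pi * x) * (Real.pi * 1))
      (fun x => ((hasDerivAt_id x).const_mul Real.pi).sin)
      (fun x => Real.abs_sin_le_one _)
      (fun x => by
        rw [abs_mul, mul_one, abs_of_pos hpi]
        exact mul_le_of_le_one_left hpi.le (Real.abs_cos_le_one _)) hu hv
    simpa [spC] using this
  · have := coord_lip hp ha hp' (fun x => Real.cos (Real.pi * x))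
      (fun x => -Real.sin (Real.pi * x) * (Real.pi * 1))
      (fun x => ((hasDerivAt_id x).const_mul Real.pi).cos)
      (fun x => Real.abs_cos_le_one _)
      (fun x => by
        rw [abs_mul, abs_neg, mul_one, abs_of_pos hpi]
        exact mul_le_of_le_one_left hpi.le (Real.abs_sin_le_one _)) hu hv
    simpa [spC] using this

lemma cover_arc {p : ℝ} (hp : 0 < p) (hp' : p < 1) :
    ∃ L : ℝ, 0 < L ∧ ∀ δ M : ℝ, 0 < δ → 0 < M →
      ∃ F : Finset (EuclideanSpace ℝ (Fin 2)), (F.card : ℝ) ≤ L * M / δ + 1 ∧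
        ∀ t, 1 ≤ t → t ^ (1 - p) ≤ M → ∃ c ∈ F, spC p t ∈ closedBall c (δ / 2) := by
  classical
  have h1p : 0 < 1 - p := by linarith
  have hpi := Real.pi_pos
  obtain ⟨a, ha⟩ : ∃ a, a = 1 / (1 - p) := ⟨_, rfl⟩
  have ha0 : 0 < a := by rw [ha]; positivity
  obtain ⟨l, hl⟩ : ∃ l, l = 2 * (a * p + Real.pi * a) := ⟨_, rfl⟩
  have hl0 : 0 < l := by rw [hl]; positivity
  refine ⟨2 * l, by positivity, fun δ M hδ hM => ?_⟩
  obtain ⟨h, hh⟩ : ∃ h, h = δ / (2 * l) := ⟨_, rfl⟩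
  have hh0 : 0 < h := by rw [hh]; positivity
  refine ⟨(Finset.range (⌊M / h⌋₊ + 1)).image fun k : ℕ => spC p ((1 + k * h) ^ a), ?_, ?_⟩
  · have h1 : (((Finset.range (⌊M / h⌋₊ + 1)).image
      fun k : ℕ => spC p ((1 + k * h) ^ a)).card : ℝ) ≤ (⌊M / h⌋₊ + 1 : ℕ) := by
      exact_mod_cast Finset.card_image_le.trans (Finset.card_range _).le
    have h2 := Nat.floor_le (show 0 ≤ M / h by positivity)
    have h3 : M / h = 2 * l * M / δ := by rw [hh]; field_simp
    push_cast at h1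
    linarith
  · intro t ht htM
    have hu : 1 ≤ t ^ (1 - p) := Real.one_le_rpow ht h1p.le
    have hta : t = (t ^ (1 - p)) ^ a := by
      rw [← Real.rpow_mul (by linarith), ha, mul_one_div_cancel h1p.ne', Real.rpow_one]
    set u := t ^ (1 - p)
    have hnn : 0 ≤ (u - 1) / h := div_nonneg (by linarith) hh0.le
    refine ⟨_, Finset.mem_image.mpr ⟨⌊(u - 1) / h⌋₊, ?_, rfl⟩, ?_⟩
    · rw [Finset.mem_range, Nat.lt_succ_iff]
      apply Nat.floor_mono
      gcongr
      linarith
    · rw [mem_closedBall, hta]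
      have hk1 := Nat.floor_le hnn
      have hk2 := Nat.lt_floor_add_one ((u - 1) / h)
      set k : ℕ := ⌊(u - 1) / h⌋₊
      rw [le_div_iff₀ hh0] at hk1
      rw [div_lt_iff₀ hh0] at hk2
      refine (spC_lip hp ha hp' (u := 1 + k * h) (v := u) ?_ hu).trans ?_
      · have : 0 ≤ (k:ℝ) * h := by positivity
        linarith
      · rw [← hl]
        have : |u - (1 + k * h)| ≤ h := by rw [abs_le]; constructor <;> linarith
        calc l * |u - (1 + k * h)| ≤ l * h := by gcongr
          _ = δ / 2 := by rw [hh]; field_simp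

lemma cover_disk {R r : ℝ} (hr : 0 < r) (hR : r ≤ R) :
    ∃ F : Finset (EuclideanSpace ℝ (Fin 2)), (F.card : ℝ) ≤ 400 * (R / r) ^ 2 ∧
      ∀ x : EuclideanSpace ℝ (Fin 2), |x 0| ≤ R → |x 1| ≤ R →
        ∃ c ∈ F, x ∈ closedBall c (r / 2) := by
  classical
  obtain ⟨ρ, hρ⟩ : ∃ ρ, ρ = r / 4 := ⟨_, rfl⟩
  have hρ0 : 0 < ρ := by rw [hρ]; positivity
  obtain ⟨N, hN⟩ : ∃ N : ℕ, N = ⌊R / ρ⌋₊ + 1 := ⟨_, rfl⟩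
  have hR0 : 0 < R := hr.trans_le hR
  have hN1 : (N : ℝ) ≤ R / ρ + 1 := by
    rw [hN]; push_cast
    linarith [Nat.floor_le (show 0 ≤ R / ρ by positivity)]
  have hN2 : R / ρ ≤ N := by
    rw [hN]; push_cast
    exact (Nat.lt_floor_add_one _).le
  have h4 : R / ρ = 4 * (R / r) := by rw [hρ]; field_simp
  have h5 : 1 ≤ R / r := by rwa [one_le_div hr]
  let I := Finset.Icc (-(N:ℤ)) N
  have hfl : ∀ y : ℝ, |y| ≤ R → ⌊y / ρ⌋ ∈ I ∧ |y - ⌊y / ρ⌋ * ρ| ≤ ρ := by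
    intro y hy
    rw [abs_le] at hy
    have a1 : y / ρ ≤ N := le_trans (by gcongr; exact hy.2) hN2
    have a2 : -(N:ℝ) ≤ y / ρ := by
      have : -(R / ρ) ≤ y / ρ := by rw [← neg_div]; gcongr; exact hy.1
      linarith
    refine ⟨Finset.mem_Icc.mpr ⟨?_, ?_⟩, ?_⟩
    · rw [Int.le_floor]; push_cast; exact a2
    · have := (Int.floor_le (y / ρ)).trans a1
      exact_mod_cast this
    · have b1 := Int.floor_le (y / ρ)
      have b2 := Int.lt_floor_add_one (y / ρ)
      rw [le_div_iff₀ hρ0] at b1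
      rw [div_lt_iff₀ hρ0] at b2
      rw [abs_le]; constructor <;> linarith
  refine ⟨(I ×ˢ I).image fun k => !₂[(k.1 : ℝ) * ρ, (k.2 : ℝ) * ρ], ?_, ?_⟩
  · have hc : I.card = 2 * N + 1 := by
      simp only [I, Int.card_Icc]; omega
    have h1 : (((I ×ˢ I).image
        fun k : ℤ × ℤ => (!₂[(k.1 : ℝ) * ρ, (k.2 : ℝ) * ρ] : EuclideanSpace ℝ (Fin 2))).card : ℝ) ≤
        ((2 * N + 1) * (2 * N + 1) : ℕ) := by
      have := Finset.card_image_le (s := I ×ˢ I)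
        (f := fun k : ℤ × ℤ => (!₂[(k.1 : ℝ) * ρ, (k.2 : ℝ) * ρ] : EuclideanSpace ℝ (Fin 2)))
      rw [Finset.card_product, hc] at this
      exact_mod_cast this
    push_cast at h1
    have h6 : (2 * N + 1 : ℝ) ≤ 20 * (R / r) := by linarith
    have h7 : (2 * N + 1 : ℝ) * (2 * N + 1) ≤ (20 * (R / r)) * (20 * (R / r)) := by gcongr
    linarith
  · intro x h0 h1
    obtain ⟨m0, e0⟩ := hfl _ h0
    obtain ⟨m1, e1⟩ := hfl _ h1
    refine ⟨_, Finset.mem_image.mpr ⟨(⌊x 0 / ρ⌋, ⌊x 1 / ρ⌋), Finset.mem_product.mpr ⟨m0, m1⟩, rfl⟩, ?_⟩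
    rw [mem_closedBall, show r / 2 = ρ + ρ by rw [hρ]; ring]
    apply dist_le_coord
    · simpa using e0
    · simpa using e1

lemma tsum_balls (F : Finset (EuclideanSpace ℝ (Fin 2))) {r s : ℝ} (hr : 0 ≤ r) :
    ∑' U : ((fun c => closedBall c (r / 2)) '' (F : Set (EuclideanSpace ℝ (Fin 2))) :
      Set (Set (EuclideanSpace ℝ (Fin 2)))),
      ENNReal.ofReal (diam (U : Set (EuclideanSpace ℝ (Fin 2))) ^ s) ≤
      ENNReal.ofReal (F.card * r ^ s) := by
  classical
  rw [← Finset.coe_image, Finset.tsum_subtype' _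
    (fun U : Set (EuclideanSpace ℝ (Fin 2)) => ENNReal.ofReal (diam U ^ s))]
  calc _ ≤ ∑ U ∈ F.image (fun c => closedBall c (r / 2)), ENNReal.ofReal (r ^ s) := by
        apply Finset.sum_le_sum
        intro U hU
        obtain ⟨c, _, rfl⟩ := Finset.mem_image.mp hU
        rw [Metric.diam_closedBall_eq c (by positivity), mul_div_cancel₀ _ (by norm_num)]
    _ = (F.image (fun c => closedBall c (r / 2))).card * ENNReal.ofReal (r ^ s) := by
        rw [Finset.sum_const, nsmul_eq_mul]
    _ ≤ F.card * ENNReal.ofReal (r ^ s) := by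
        gcongr
        exact Finset.card_image_le
    _ = _ := by
        rw [ENNReal.ofReal_mul (by positivity), ENNReal.ofReal_natCast]

lemma upper_cover {p θ : ℝ} (hp : 0 < p) (hp' : p < 1) (hθ : 0 < θ) (hθ' : θ ≤ 1) {s s' : ℝ}
    (hs : s = 1 + θ * (1 - p) / (2 * p + θ * (1 - p))) (hss : s < s') :
    ∃ K : ℝ, 0 < K ∧ ∀ δ : ℝ, 0 < δ → δ < 1 →
      ∃ 𝒰 : Set (Set (EuclideanSpace ℝ (Fin 2))), 𝒰.Countable ∧ polySpiral p ⊆ ⋃₀ 𝒰 ∧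
      (∀ U ∈ 𝒰, δ ≤ diam U ∧ diam U ≤ δ ^ θ) ∧
      ∑' U : 𝒰, ENNReal.ofReal (diam (U : Set (EuclideanSpace ℝ (Fin 2))) ^ s') ≤
        ENNReal.ofReal (K * δ ^ (θ * (s' - s))) := by
  obtain ⟨L, hL, harc⟩ := cover_arc hp hp'
  refine ⟨L + 1 + 400, by positivity, fun δ hδ hδ1 => ?_⟩
  have h1p : 0 < 1 - p := by linarith
  have hD : 0 < 2 * p + θ * (1 - p) := by positivity
  set D := 2 * p + θ * (1 - p) with hDdef
  obtain ⟨T, hT⟩ : ∃ T, T = δ ^ (-(θ / D)) := ⟨_, rfl⟩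
  have hT0 : 0 < T := hT ▸ Real.rpow_pos_of_pos hδ _
  have hs2 : 2 - s = 2 * p / D := by
    rw [hs]; field_simp; rw [hDdef]; ring
  have hM : T ^ (1 - p) = δ ^ (1 - s) := by
    rw [hT, ← Real.rpow_mul hδ.le, hs]; congr 1; field_simp; ring
  have hRe : T ^ (-p) = δ ^ (θ * (p / D)) := by
    rw [hT, ← Real.rpow_mul hδ.le]; congr 1; field_simp
  have hM0 : 0 < T ^ (1 - p) := Real.rpow_pos_of_pos hT0 _
  have hδθ : 0 < δ ^ θ := Real.rpow_pos_of_pos hδ _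
  have hδle : δ ≤ δ ^ θ := by
    calc δ = δ ^ (1:ℝ) := (Real.rpow_one δ).symm
      _ ≤ δ ^ θ := Real.rpow_le_rpow_of_exponent_ge hδ hδ1.le hθ'
  have hRr : δ ^ θ ≤ T ^ (-p) := by
    rw [hRe]
    apply Real.rpow_le_rpow_of_exponent_ge hδ hδ1.le
    apply mul_le_of_le_one_right hθ.le
    rw [div_le_one hD, hDdef]
    have : 0 < θ * (1 - p) := by positivity
    linarith
  obtain ⟨F, hF, hFc⟩ := harc δ (T ^ (1 - p)) hδ hM0
  obtain ⟨G, hG, hGc⟩ := cover_disk hδθ hRr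
  refine ⟨(fun c => closedBall c (δ / 2)) '' (F : Set _) ∪
    (fun c => closedBall c (δ ^ θ / 2)) '' (G : Set _), ?_, ?_, ?_, ?_⟩
  · exact ((F.countable_toSet).image _).union ((G.countable_toSet).image _)
  · intro x hx
    obtain ⟨t, ht, rfl⟩ := mem_spC hx
    rcases le_total t T with h | h
    · obtain ⟨c, hc, hm⟩ := hFc t ht (Real.rpow_le_rpow (by linarith) h h1p.le)
      exact ⟨_, Or.inl ⟨c, hc, rfl⟩, hm⟩
    · have h0 : 0 < t ^ (-p) := Real.rpow_pos_of_pos (by linarith) _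
      have h1 : t ^ (-p) ≤ T ^ (-p) := Real.rpow_le_rpow_of_nonpos hT0 h (by linarith)
      have key : ∀ y : ℝ, |y| ≤ 1 → |t ^ (-p) * y| ≤ T ^ (-p) := fun y hy => by
        rw [abs_mul, abs_of_pos h0]
        exact (mul_le_of_le_one_right h0.le hy).trans h1
      obtain ⟨c, hc, hm⟩ := hGc (spC p t)
        (by simpa [spC] using key _ (Real.abs_sin_le_one (Real.pi * t)))
        (by simpa [spC] using key _ (Real.abs_cos_le_one (Real.pi * t)))
      exact ⟨_, Or.inr ⟨c, hc, rfl⟩, hm⟩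
  · rintro U (⟨c, _, rfl⟩ | ⟨c, _, rfl⟩)
    · simp only
      rw [Metric.diam_closedBall_eq c (by positivity), mul_div_cancel₀ _ (by norm_num)]
      exact ⟨le_rfl, hδle⟩
    · simp only
      rw [Metric.diam_closedBall_eq c (by positivity), mul_div_cancel₀ _ (by norm_num)]
      exact ⟨hδle, le_rfl⟩
  · refine (ENNReal.tsum_union_le
      (fun U : Set (EuclideanSpace ℝ (Fin 2)) => ENNReal.ofReal (diam U ^ s')) _ _).trans ?_
    refine (add_le_add (tsum_balls F hδ.le) (tsum_balls G hδθ.le)).trans ?_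
    rw [← ENNReal.ofReal_add (by positivity) (by positivity)]
    apply ENNReal.ofReal_le_ofReal
    have c1 : F.card * δ ^ s' ≤ (L + 1) * δ ^ (θ * (s' - s)) := by
      have e : T ^ (1 - p) / δ * δ ^ s' = δ ^ (s' - s) := by
        rw [hM, ← Real.rpow_sub_one hδ.ne', ← Real.rpow_add hδ]; congr 1; ring
      have one : 1 ≤ T ^ (1 - p) / δ := by
        rw [hM, ← Real.rpow_sub_one hδ.ne']
        apply Real.one_le_rpow_of_pos_of_le_one_of_nonpos hδ hδ1.le
        have : 0 ≤ θ * (1 - p) / D := by positivity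
        linarith
      calc F.card * δ ^ s' ≤ ((L + 1) * (T ^ (1 - p) / δ)) * δ ^ s' := by
            gcongr
            calc (F.card : ℝ) ≤ L * T ^ (1 - p) / δ + 1 := hF
              _ ≤ L * T ^ (1 - p) / δ + T ^ (1 - p) / δ := by gcongr
              _ = _ := by ring
        _ = (L + 1) * δ ^ (s' - s) := by rw [mul_assoc, e]
        _ ≤ _ := by
            have : δ ^ (s' - s) ≤ δ ^ (θ * (s' - s)) := by
              apply Real.rpow_le_rpow_of_exponent_ge hδ hδ1.le
              exact mul_le_of_le_one_left (by linarith) hθ'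
            gcongr
    have c2 : G.card * (δ ^ θ) ^ s' ≤ 400 * δ ^ (θ * (s' - s)) := by
      have e : (T ^ (-p) / δ ^ θ) ^ 2 * (δ ^ θ) ^ s' = δ ^ (θ * (s' - s)) := by
        rw [hRe, ← Real.rpow_sub hδ, ← Real.rpow_natCast, ← Real.rpow_mul hδ.le,
          ← Real.rpow_mul hδ.le, ← Real.rpow_add hδ]
        congr 1
        push_cast
        linear_combination (-θ) * hs2
      calc G.card * (δ ^ θ) ^ s' ≤ (400 * (T ^ (-p) / δ ^ θ) ^ 2) * (δ ^ θ) ^ s' := by gcongr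
        _ = _ := by rw [mul_assoc, e]
    linarith

lemma upper_bound {p θ : ℝ} (hp : 0 < p) (hp' : p < 1) (hθ : 0 < θ) (hθ' : θ ≤ 1) {s s' : ℝ}
    (hs : s = 1 + θ * (1 - p) / (2 * p + θ * (1 - p))) (hss : s < s') :
    ∀ ε : ℝ, 0 < ε → ∃ δ₀ : ℝ, 0 < δ₀ ∧ ∀ δ : ℝ, 0 < δ → δ < δ₀ →
      ∃ 𝒰 : Set (Set (EuclideanSpace ℝ (Fin 2))), 𝒰.Countable ∧ polySpiral p ⊆ ⋃₀ 𝒰 ∧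
      (∀ U ∈ 𝒰, δ ≤ diam U ∧ diam U ≤ δ ^ θ) ∧
      ∑' U : 𝒰, ENNReal.ofReal (diam (U : Set (EuclideanSpace ℝ (Fin 2))) ^ s') ≤
        ENNReal.ofReal ε := by
  intro ε hε
  obtain ⟨K, hK, h⟩ := upper_cover hp hp' hθ hθ' hs hss
  have he : 0 < θ * (s' - s) := mul_pos hθ (by linarith)
  refine ⟨min 1 ((ε / K) ^ (θ * (s' - s))⁻¹), by positivity, fun δ hδ hδ1 => ?_⟩
  obtain ⟨𝒰, h1, h2, h3, h4⟩ := h δ hδ (hδ1.trans_le (min_le_left _ _))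
  refine ⟨𝒰, h1, h2, h3, h4.trans (ENNReal.ofReal_le_ofReal ?_)⟩
  have h5 : δ ^ (θ * (s' - s)) ≤ ε / K := by
    calc δ ^ (θ * (s' - s)) ≤ ((ε / K) ^ (θ * (s' - s))⁻¹) ^ (θ * (s' - s)) :=
          Real.rpow_le_rpow hδ.le (hδ1.trans_le (min_le_right _ _)).le he.le
      _ = ε / K := Real.rpow_inv_rpow (by positivity) he.ne'
  rw [le_div_iff₀ hK] at h5
  linarith

lemma sInf_eq_of {A : Set ℝ} {s : ℝ} (h1 : ∀ x ∈ A, s ≤ x) (h2 : ∀ x, s < x → x ∈ A) :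
    sInf A = s := by
  apply le_antisymm
  · apply le_of_forall_gt_imp_ge_of_dense
    intro x hx
    exact csInf_le ⟨s, h1⟩ (h2 x hx)
  · exact le_csInf ⟨s + 1, h2 _ (by linarith)⟩ h1

theorem stmt3 (p θ : ℝ) (hp : 0 < p) (hp' : p < 1) (hθ : 0 < θ) (hθ' : θ ≤ 1) :
    lodim θ (polySpiral p) = 1 + θ * (1 - p) / (2 * p + θ * (1 - p)) ∧
      updim θ (polySpiral p) = 1 + θ * (1 - p) / (2 * p + θ * (1 - p)) := by
  have h1p : 0 < 1 - p := by linarith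
  have hs0 : 0 ≤ 1 + θ * (1 - p) / (2 * p + θ * (1 - p)) := by positivity
  constructor
  · apply sInf_eq_of
    · rintro x ⟨_, hx⟩
      exact lower_bound hp hp' hθ rfl hx
    · intro x hx
      refine ⟨hs0.trans hx.le, fun ε hε δ₁ hδ₁ => ?_⟩
      obtain ⟨δ₀, h0, h⟩ := upper_bound hp hp' hθ hθ' rfl hx ε hε
      have hm : 0 < min δ₀ δ₁ := lt_min h0 hδ₁
      exact ⟨min δ₀ δ₁ / 2, by positivity, by linarith [min_le_right δ₀ δ₁],
        h _ (by positivity) (by linarith [min_le_left δ₀ δ₁])⟩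
  · apply sInf_eq_of
    · rintro x ⟨_, hx⟩
      refine lower_bound hp hp' hθ rfl fun ε hε δ₁ hδ₁ => ?_
      obtain ⟨δ₀, h0, h⟩ := hx ε hε
      have hm : 0 < min δ₀ δ₁ := lt_min h0 hδ₁
      exact ⟨min δ₀ δ₁ / 2, by positivity, by linarith [min_le_right δ₀ δ₁],
        h _ (by positivity) (by linarith [min_le_left δ₀ δ₁])⟩
    · intro x hx
      exact ⟨hs0.trans hx.le, upper_bound hp hp' hθ hθ' rfl hx⟩
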